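/- arXiv:1602.02334 — 2 statements merged into one kernel-verified Lean document; each statement's English description precedes it below -/
import Mathlib

section
/- Let Σ be a set of matching dependencies all of whose matching functions are similarity-preserving, and let D₀ be any initial instance. Then there is a unique (D₀,Σ)-clean instance, i.e., every maximal chase sequence of MD enforcements starting from D₀ terminates in the same stable instance. -/
namespace ERBlox

/-- A classical matching dependency over attribute set `Attr`: the LHS is a list of
pairs of comparable attributes compared via similarity, the RHS is a single pair of
attributes whose values are to be identified (matched). -/
structure MD (Attr : Type) where
  lhs : List (Attr × Attr)
  rhs : Attr × Attr

variable {Tid Attr Val : Type}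

/-- The set of attributes appearing in similarity atoms on the LHS of an MD. -/
def ALHS (φ : MD Attr) : Set Attr :=
  {A | ∃ p ∈ φ.lhs, p.1 = A ∨ p.2 = A}

/-- The set of attributes appearing in the identity atom on the RHS of an MD. -/
def ARHS (φ : MD Attr) : Set Attr := {φ.rhs.1, φ.rhs.2}

/-- A set of MDs is interaction-free if no attribute occurs both in a LHS and in a
RHS of MDs of the set. -/
def InteractionFree (Sgm : Set (MD Attr)) : Prop :=
  ∀ φ₁ ∈ Sgm, ∀ φ₂ ∈ Sgm, ALHS φ₁ ∩ ARHS φ₂ = ∅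

/-- A matching function is idempotent, commutative and associative. -/
def IsMatchingFn (m : Val → Val → Val) : Prop :=
  (∀ a, m a a = a) ∧ (∀ a b, m a b = m b a) ∧ (∀ a b c, m (m a b) c = m a (m b c))

/-- The similarity conditions on the LHS of MD `φ` hold for tuples `t₁, t₂` in
instance `D` (an instance assigns a value to every tuple identifier and attribute). -/
def lhsHolds (sim : Val → Val → Prop) (φ : MD Attr) (D : Tid → Attr → Val)
    (t₁ t₂ : Tid) : Prop :=
  ∀ p ∈ φ.lhs, sim (D t₁ p.1) (D t₂ p.2)

/-- `LHS(φ)` is true in the set `S` of tuples of instance `D`. -/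
def lhsTrueIn (sim : Val → Val → Prop) (φ : MD Attr) (D : Tid → Attr → Val)
    (S : Set Tid) : Prop :=
  ∃ t₁ ∈ S, ∃ t₂ ∈ S, lhsHolds sim φ D t₁ t₂

/-- The combination of a set of (classical) MDs and an instance is SFAI
(similarity-free attribute intersection). -/
def SFAI (sim : Val → Val → Prop) (Sgm : Set (MD Attr)) (D : Tid → Attr → Val) : Prop :=
  InteractionFree Sgm ∨
    ∀ φ₁ ∈ Sgm, ∀ φ₂ ∈ Sgm, ∀ A ∈ ALHS φ₂ ∩ ARHS φ₁, ∀ t₁ t₂ t₃ : Tid,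
      ¬ lhsTrueIn sim φ₁ D {t₁, t₂} ∨ ¬ lhsTrueIn sim φ₂ D {t₂, t₃}

/-- MD `φ` is applicable on tuples `t₁, t₂` of `D`: the LHS similarities hold but
the RHS values differ. -/
def Applicable (sim : Val → Val → Prop) (φ : MD Attr) (D : Tid → Attr → Val)
    (t₁ t₂ : Tid) : Prop :=
  lhsHolds sim φ D t₁ t₂ ∧ D t₁ φ.rhs.1 ≠ D t₂ φ.rhs.2

/-- `D'` is the immediate result of enforcing MD `φ` on tuples `t₁, t₂` of `D`,
using matching function `m` on the RHS values; everything else is unchanged. -/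
def EnforceStep (sim : Val → Val → Prop) (m : Val → Val → Val) (φ : MD Attr)
    (t₁ t₂ : Tid) (D D' : Tid → Attr → Val) : Prop :=
  Applicable sim φ D t₁ t₂ ∧
  D' t₁ φ.rhs.1 = m (D t₁ φ.rhs.1) (D t₂ φ.rhs.2) ∧
  D' t₂ φ.rhs.2 = m (D t₁ φ.rhs.1) (D t₂ φ.rhs.2) ∧
  ∀ t X, ¬ ((t = t₁ ∧ X = φ.rhs.1) ∨ (t = t₂ ∧ X = φ.rhs.2)) → D' t X = D t X

/-- One chase step: enforcement of some MD of `Sgm` on some pair of tuples. -/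
def ChaseStep (sim : Val → Val → Prop) (m : Val → Val → Val) (Sgm : Set (MD Attr))
    (D D' : Tid → Attr → Val) : Prop :=
  ∃ φ ∈ Sgm, ∃ t₁ t₂ : Tid, EnforceStep sim m φ t₁ t₂ D D'

/-- An instance is stable when no MD of `Sgm` is applicable. -/
def Stable (sim : Val → Val → Prop) (Sgm : Set (MD Attr)) (D : Tid → Attr → Val) : Prop :=
  ∀ φ ∈ Sgm, ∀ t₁ t₂ : Tid, ¬ Applicable sim φ D t₁ t₂

/-- `D` is a `(D₀,Sgm)`-clean instance: a stable instance reached from `D₀` by a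
finite sequence of chase steps. -/
def Clean (sim : Val → Val → Prop) (m : Val → Val → Val) (Sgm : Set (MD Attr))
    (D₀ D : Tid → Attr → Val) : Prop :=
  Relation.ReflTransGen (ChaseStep sim m Sgm) D₀ D ∧ Stable sim Sgm D

section Semilattice

variable [SemilatticeSup Val] {sim : Val → Val → Prop} {Sgm : Set (MD Attr)}
  {D D' E : Tid → Attr → Val}

theorem EnforceStep.le {φ : MD Attr} {t₁ t₂ : Tid}
    (h : EnforceStep sim (· ⊔ ·) φ t₁ t₂ D D') : D ≤ D' := by
  obtain ⟨-, h₁, h₂, h₃⟩ := h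
  intro t X
  by_cases hX : (t = t₁ ∧ X = φ.rhs.1) ∨ (t = t₂ ∧ X = φ.rhs.2)
  · rcases hX with ⟨rfl, rfl⟩ | ⟨rfl, rfl⟩
    · exact h₁ ▸ le_sup_left
    · exact h₂ ▸ le_sup_right
  · exact (h₃ t X hX).ge

theorem EnforceStep.ne {φ : MD Attr} {t₁ t₂ : Tid}
    (h : EnforceStep sim (· ⊔ ·) φ t₁ t₂ D D') : D ≠ D' := by
  rintro rfl
  exact h.1.2 (h.2.1.trans h.2.2.1.symm)

theorem le_of_chase (h : Relation.ReflTransGen (ChaseStep sim (· ⊔ ·) Sgm) D D') : D ≤ D' := by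
  induction h with
  | refl => exact le_rfl
  | tail _ hs ih =>
    obtain ⟨φ, -, t₁, t₂, hs⟩ := hs
    exact ih.trans hs.le

theorem lhsHolds.mono (hsymm : ∀ a b, sim a b → sim b a)
    (hsp : ∀ a a' a'' : Val, sim a a' → sim a (a' ⊔ a''))
    (hDE : D ≤ E) {φ : MD Attr} {t₁ t₂ : Tid} (h : lhsHolds sim φ D t₁ t₂) :
    lhsHolds sim φ E t₁ t₂ := by
  have hmono : ∀ {a b c : Val}, sim a b → b ≤ c → sim a c := fun {a b c} hab hbc => by
    simpa [sup_eq_right.2 hbc] using hsp a b c hab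
  intro p hp
  exact hsymm _ _ (hmono (hsymm _ _ (hmono (h p hp) (hDE t₂ p.2))) (hDE t₁ p.1))

/-- A stable instance above the start of a chase is above all instances of the chase. -/
theorem Stable.chase_le (hE : Stable sim Sgm E) (hsymm : ∀ a b, sim a b → sim b a)
    (hsp : ∀ a a' a'' : Val, sim a a' → sim a (a' ⊔ a'')) (hDE : D ≤ E)
    (h : Relation.ReflTransGen (ChaseStep sim (· ⊔ ·) Sgm) D D') : D' ≤ E := by
  induction h with
  | refl => exact hDE
  | tail _ hs ih =>
    obtain ⟨φ, hφ, t₁, t₂, ⟨hlhs, -⟩, h₁, h₂, h₃⟩ := hs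
    have heq : E t₁ φ.rhs.1 = E t₂ φ.rhs.2 :=
      of_not_not fun hne => hE φ hφ t₁ t₂ ⟨hlhs.mono hsymm hsp ih, hne⟩
    intro t X
    by_cases hX : (t = t₁ ∧ X = φ.rhs.1) ∨ (t = t₂ ∧ X = φ.rhs.2)
    · rcases hX with ⟨rfl, rfl⟩ | ⟨rfl, rfl⟩
      · exact h₁.le.trans (sup_le (ih _ _) ((ih _ _).trans heq.ge))
      · exact h₂.le.trans (sup_le ((ih _ _).trans heq.le) (ih _ _))
    · exact (h₃ t X hX).le.trans (ih t X)

theorem mem_of_chase {S : Set Val} (hS : SupClosed S) (hD : ∀ t X, D t X ∈ S)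
    (h : Relation.ReflTransGen (ChaseStep sim (· ⊔ ·) Sgm) D D') : ∀ t X, D' t X ∈ S := by
  induction h with
  | refl => exact hD
  | tail _ hs ih =>
    obtain ⟨φ, -, t₁, t₂, -, h₁, h₂, h₃⟩ := hs
    intro t X
    by_cases hX : (t = t₁ ∧ X = φ.rhs.1) ∨ (t = t₂ ∧ X = φ.rhs.2)
    · rcases hX with ⟨rfl, rfl⟩ | ⟨rfl, rfl⟩
      · exact h₁ ▸ hS (ih _ _) (ih _ _)
      · exact h₂ ▸ hS (ih _ _) (ih _ _)
    · exact h₃ t X hX ▸ ih t X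

theorem finite_setOf_chase [Finite Tid] [Finite Attr] (D : Tid → Attr → Val) :
    {D' | Relation.ReflTransGen (ChaseStep sim (· ⊔ ·) Sgm) D D'}.Finite := by
  let S : Set Val := supClosure (Set.range fun p : Tid × Attr => D p.1 p.2)
  have hS : S.Finite := (Set.finite_range _).supClosure
  refine (Set.Finite.pi' fun _ : Tid => Set.Finite.pi' fun _ : Attr => hS).subset fun D' h => ?_
  exact mem_of_chase supClosed_supClosure (fun t X => subset_supClosure ⟨(t, X), rfl⟩) h

end Semilattice

theorem Applicable.exists_enforceStep {sim : Val → Val → Prop} {m : Val → Val → Val}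
    {φ : MD Attr} {t₁ t₂ : Tid} {D : Tid → Attr → Val} (h : Applicable sim φ D t₁ t₂) :
    ∃ D', EnforceStep sim m φ t₁ t₂ D D' := by
  classical
  refine ⟨fun t X => if (t = t₁ ∧ X = φ.rhs.1) ∨ (t = t₂ ∧ X = φ.rhs.2) then
    m (D t₁ φ.rhs.1) (D t₂ φ.rhs.2) else D t X, h, ?_, ?_, fun t X hX => if_neg hX⟩ <;> simp

theorem exists_clean [SemilatticeSup Val] [Finite Tid] [Finite Attr]
    (sim : Val → Val → Prop) (Sgm : Set (MD Attr)) (D₀ : Tid → Attr → Val) :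
    ∃ D, Clean sim (· ⊔ ·) Sgm D₀ D := by
  obtain ⟨D, hD⟩ := (finite_setOf_chase (sim := sim) (Sgm := Sgm) D₀).exists_maximal
    ⟨D₀, Relation.ReflTransGen.refl⟩
  refine ⟨D, hD.prop, fun φ hφ t₁ t₂ happ => ?_⟩
  obtain ⟨D', hD'⟩ := happ.exists_enforceStep (m := (· ⊔ ·))
  exact hD'.ne (hD.eq_of_le (hD.prop.tail ⟨φ, hφ, t₁, t₂, hD'⟩) hD'.le)

theorem Clean.le [SemilatticeSup Val] {sim : Val → Val → Prop} {Sgm : Set (MD Attr)}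
    {D₀ D E : Tid → Attr → Val} (hsymm : ∀ a b, sim a b → sim b a)
    (hsp : ∀ a a' a'' : Val, sim a a' → sim a (a' ⊔ a''))
    (hD : Clean sim (· ⊔ ·) Sgm D₀ D) (hE : Clean sim (· ⊔ ·) Sgm D₀ E) : D ≤ E :=
  hE.2.chase_le hsymm hsp (le_of_chase hE.1) hD.1

/-- If all matching functions used by the MDs of `Sgm` are
similarity-preserving, then for any initial instance `D₀` there is a unique
`(D₀,Sgm)`-clean instance. -/
theorem unique_clean_of_similarity_preserving
    {Tid Attr Val : Type} [Fintype Tid] [Fintype Attr]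
    (sim : Val → Val → Prop) (m : Val → Val → Val)
    (hrefl : ∀ a, sim a a) (hsymm : ∀ a b, sim a b → sim b a)
    (hm : IsMatchingFn m)
    (hsp : ∀ a a' a'' : Val, sim a a' → sim a (m a' a''))
    (Sgm : Set (MD Attr)) (D₀ : Tid → Attr → Val) :
    ∃! D : Tid → Attr → Val, Clean sim m Sgm D₀ D := by
  let _ : Max Val := ⟨m⟩
  let _ : SemilatticeSup Val := SemilatticeSup.mk' hm.2.1 hm.2.2 hm.1
  obtain ⟨D, hD⟩ := exists_clean sim Sgm D₀
  exact ⟨D, hD, fun E hE => le_antisymm (Clean.le hsymm hsp hE hD) (Clean.le hsymm hsp hD hE)⟩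

end ERBlox
end

section
/- Let M be the set of duplicate pairs output by the classifier, with similarities (r₁,r₂) ∈ M precomputed and stored so that they are not destroyed by updates of attribute values, and let Σ^M be the corresponding set of merge-MDs. If (r₁,r₂) ∈ M and (r₂,r₃) ∈ M, but (r₁,r₃) ∉ M, then in the unique resolved instance obtained by exhaustively enforcing Σ^M, the records r₁, r₂ and r₃ all end up with the same attribute values on all merged attributes (i.e., identical except possibly for their record identifiers): enforcing the merge of r₁ with r₂ preserves the stored similarity between r₂ and r₃, so the merge-MD subsequently applies to r₃ and the new version of r₂, and iteration equates all three. -/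
namespace ERBlox

variable {Tid Attr Val : Type}

/-- The similarity `≈_id` on record-identifier values induced by the set `M` of
duplicate pairs output by the classifier: two rid-values are similar iff they are
the identifiers of a pair of records in `M`. -/
def simId {Tid Val : Type} (M : Set (Tid × Tid)) (idv : Tid → Val) :
    Val → Val → Prop :=
  fun v v' => ∃ p ∈ M, v = idv p.1 ∧ v' = idv p.2

/-- The set of merge-MDs induced by `M`: for each attribute `A` other than the
record identifier `ridA` and the block number `blA`, the MD
`r₁[rid] ≈_id r₂[rid] → r₁[A] ≐ r₂[A]` (the conjunction of identity atoms of a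
merge-MD is represented by one MD per merged attribute, all with the same LHS). -/
def mergeMDs {Attr : Type} (ridA blA : Attr) : Set (MD Attr) :=
  {φ | ∃ A : Attr, A ≠ ridA ∧ A ≠ blA ∧ φ = MD.mk [(ridA, ridA)] (A, A)}

/-- Enforcing merge-MDs never changes the record identifiers. -/
theorem rid_eq_of_reflTransGen {sim : Val → Val → Prop} {m : Val → Val → Val}
    {ridA blA : Attr} {D₀ D : Tid → Attr → Val}
    (h : Relation.ReflTransGen (ChaseStep sim m (mergeMDs ridA blA)) D₀ D) (t : Tid) :
    D t ridA = D₀ t ridA := by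
  induction h with
  | refl => rfl
  | tail _ hstep ih =>
    obtain ⟨_, ⟨A, hA, _, rfl⟩, t₁, t₂, _, _, _, hframe⟩ := hstep
    rw [hframe t ridA (by rintro (⟨_, h⟩ | ⟨_, h⟩) <;> exact hA h.symm), ih]

/-- In a clean instance, records paired by the classifier agree on merged attributes. -/
theorem eq_of_clean_of_mem {ridA blA : Attr} {M : Set (Tid × Tid)} {idv : Tid → Val}
    {m : Val → Val → Val} {D₀ D : Tid → Attr → Val} (hrid : ∀ t, D₀ t ridA = idv t)
    (hclean : Clean (simId M idv) m (mergeMDs ridA blA) D₀ D)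
    {s t : Tid} (hst : (s, t) ∈ M) {A : Attr} (hA : A ≠ ridA) (hA' : A ≠ blA) :
    D s A = D t A := by
  by_contra hne
  refine hclean.2 _ ⟨A, hA, hA', rfl⟩ s t ⟨fun p hp => ?_, hne⟩
  obtain rfl := List.mem_singleton.1 hp
  exact ⟨(s, t), hst, (rid_eq_of_reflTransGen hclean.1 s).trans (hrid s),
    (rid_eq_of_reflTransGen hclean.1 t).trans (hrid t)⟩

/-- Transitive merging.  If the classifier output `M` contains
`(r₁,r₂)` and `(r₂,r₃)` but not `(r₁,r₃)`, then in the unique resolved instance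
obtained by exhaustively enforcing the merge-MDs (the `≈_id` similarities being
determined by the immutable record identifiers, hence not destroyed by updates
of attribute values), the records `r₁`, `r₂`, `r₃` end up with the same values
on all merged attributes, i.e., on all attributes other than the record
identifier and the block number. -/
theorem merge_mds_transitive_merging
    {Tid Attr Val : Type}
    (ridA blA : Attr)
    (M : Set (Tid × Tid))
    (idv : Tid → Val) (hinj : Function.Injective idv)
    (m : Val → Val → Val) (hm : IsMatchingFn m)
    (r₁ r₂ r₃ : Tid)
    (h12 : (r₁, r₂) ∈ M) (h23 : (r₂, r₃) ∈ M) (h13 : (r₁, r₃) ∉ M)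
    (D₀ : Tid → Attr → Val) (hrid : ∀ t, D₀ t ridA = idv t)
    (D : Tid → Attr → Val)
    (hclean : Clean (simId M idv) m (mergeMDs ridA blA) D₀ D) :
    ∀ A : Attr, A ≠ ridA → A ≠ blA →
      D r₁ A = D r₂ A ∧ D r₂ A = D r₃ A ∧ D r₁ A = D r₃ A := by
  intro A hA hA'
  have h₁ := eq_of_clean_of_mem hrid hclean h12 hA hA'
  have h₂ := eq_of_clean_of_mem hrid hclean h23 hA hA'
  exact ⟨h₁, h₂, h₁.trans h₂⟩

end ERBlox
end
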